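/- For every n ≥ 1, the number of rooted planar trees with n+1 leaves in which every internal node has at least two children (the n-th small Schröder number) is the binomial transform of the numbers of (h,u)-colored Motzkin paths: |PT(n)| = Σ_{k=1}^{n} binom(n−1, k−1)·|huMP(k)|. -/

import Mathlib

/-! Schröder paths -/

inductive SStep : Type
  | H | V | D
deriving DecidableEq

def SStep.dx : SStep → ℕ
  | .H => 1 | .V => 0 | .D => 1

def SStep.dy : SStep → ℕ
  | .H => 0 | .V => 1 | .D => 1

def pathX (p : List SStep) : ℕ := (p.map SStep.dx).sum
def pathY (p : List SStep) : ℕ := (p.map SStep.dy).sum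

/-- A Schröder path of semilength `n`: from (0,0) to (n,n), steps H,V,D,
never rising above the diagonal. -/
def IsSchroder (n : ℕ) (p : List SStep) : Prop :=
  pathX p = n ∧ pathY p = n ∧ ∀ q : List SStep, q <+: p → pathY q ≤ pathX q

/-- No diagonal step starts on the diagonal. -/
def DiagFree (p : List SStep) : Prop :=
  ∀ q r : List SStep, p = q ++ SStep.D :: r → pathX q ≠ pathY q

/-- Every diagonal step is immediately followed by a horizontal step,
except if it is the last step. -/
def DFollowedByH (p : List SStep) : Prop :=
  ∀ q r : List SStep, p = q ++ SStep.D :: r → r = [] ∨ ∃ r' : List SStep, r = SStep.H :: r'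

def SP (n m : ℕ) : Type := {p : List SStep // IsSchroder n p ∧ p.count SStep.D + m = n}
def SPplus (n m : ℕ) : Type :=
  {p : List SStep // IsSchroder n p ∧ p.count SStep.D + m = n ∧ DiagFree p}
def SPzero (n m : ℕ) : Type :=
  {p : List SStep // IsSchroder n p ∧ p.count SStep.D + m = n ∧ ¬ DiagFree p}
def RP (n m : ℕ) : Type :=
  {p : List SStep // IsSchroder n p ∧ p.count SStep.D + m = n ∧ DFollowedByH p}

/-! Rooted planar trees -/

inductive PTree : Type
  | node : List PTree → PTree

namespace PTree

def leaves : PTree → ℕ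
  | node [] => 1
  | node (c :: cs) => ((c :: cs).attach.map fun x => leaves x.1).sum
decreasing_by
  have := List.sizeOf_lt_of_mem x.2
  simp only [PTree.node.sizeOf_spec, List.cons.sizeOf_spec] at this ⊢
  omega

def internal : PTree → ℕ
  | node [] => 0
  | node (c :: cs) => 1 + ((c :: cs).attach.map fun x => internal x.1).sum
decreasing_by
  have := List.sizeOf_lt_of_mem x.2
  simp only [PTree.node.sizeOf_spec, List.cons.sizeOf_spec] at this ⊢
  omega

def Good : PTree → Prop
  | node cs => cs.length ≠ 1 ∧ ∀ c ∈ cs.attach, Good c.1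
decreasing_by
  have := List.sizeOf_lt_of_mem c.2
  simp only [PTree.node.sizeOf_spec] at this ⊢
  omega

end PTree

def PT (n m : ℕ) : Type :=
  {t : PTree // t.Good ∧ t.leaves = n + 1 ∧ t.internal = m}

def PTn (n : ℕ) : Type := {t : PTree // t.Good ∧ t.leaves = n + 1}

/-! Motzkin paths -/

inductive MStep : Type
  | U | H | D
deriving DecidableEq

def MStep.dh : MStep → ℤ
  | .U => 1 | .H => 0 | .D => -1

def mHeight (p : List MStep) : ℤ := (p.map MStep.dh).sum

def IsMotzkin (k : ℕ) (p : List MStep) : Prop :=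
  p.length = k ∧ mHeight p = 0 ∧ ∀ q : List MStep, q <+: p → 0 ≤ mHeight q

def HFollowedByU (p : List MStep) : Prop :=
  ∀ q r : List MStep, p = q ++ MStep.H :: r → r = [] ∨ ∃ r' : List MStep, r = MStep.U :: r'

def MP (k : ℕ) : Type := {p : List MStep // IsMotzkin k p}
def RMP (k : ℕ) : Type := {p : List MStep // IsMotzkin k p ∧ HFollowedByU p}

/-- Motzkin steps with two possible colors on up and horizontal steps. -/
inductive CMStep : Type
  | U : Bool → CMStep
  | H : Bool → CMStep
  | D : CMStep
deriving DecidableEq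

def CMStep.forget : CMStep → MStep
  | .U _ => .U | .H _ => .H | .D => .D

/-- (h,u)-colored Motzkin paths of length n-1. -/
def huMP (n : ℕ) : Type := {p : List CMStep // IsMotzkin (n - 1) (p.map CMStep.forget)}


open PowerSeries

/-- The fiber over `n` of a size function, i.e. the objects of size `n`. -/
abbrev SizeFiber {α : Type*} (s : α → ℕ) (n : ℕ) : Type _ := {a : α // s a = n}

/-- The ordinary generating function of a combinatorial class with size function `s`. -/
noncomputable def genFun {α : Type*} (s : α → ℕ) : ℤ⟦X⟧ :=
  PowerSeries.mk fun n => (Nat.card (SizeFiber s n) : ℤ)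

lemma genFun_congr {α β : Type*} {s : α → ℕ} {t : β → ℕ} (e : α ≃ β) (h : ∀ a, t (e a) = s a) :
    genFun s = genFun t := by
  ext n
  simp only [genFun, coeff_mk, Nat.cast_inj]
  exact Nat.card_congr (e.subtypeEquiv fun a => by rw [h])

lemma genFun_sum {α β : Type*} {s : α → ℕ} {t : β → ℕ} (hs : ∀ n, Finite (SizeFiber s n))
    (ht : ∀ n, Finite (SizeFiber t n)) : genFun (Sum.elim s t) = genFun s + genFun t := by
  ext n
  have : Finite {a // Sum.elim s t (.inl a) = n} := hs n
  have : Finite {b // Sum.elim s t (.inr b) = n} := ht n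
  simp only [genFun, coeff_mk, map_add]
  rw [Nat.card_congr (Equiv.subtypeSum (p := fun c => Sum.elim s t c = n)), Nat.card_sum,
    Nat.cast_add]
  rfl

/-- An object of size `n` in a product class is a pair of objects whose sizes add up to `n`. -/
def sizeFiberProdEquiv {α β : Type*} (s : α → ℕ) (t : β → ℕ) (n : ℕ) :
    SizeFiber (fun p : α × β => s p.1 + t p.2) n ≃
      Σ i : Finset.HasAntidiagonal.antidiagonal n, SizeFiber s i.1.1 × SizeFiber t i.1.2 where
  toFun p := ⟨⟨(s p.1.1, t p.1.2), Finset.HasAntidiagonal.mem_antidiagonal.2 p.2⟩, ⟨p.1.1, rfl⟩, ⟨p.1.2, rfl⟩⟩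
  invFun q := ⟨(q.2.1.1, q.2.2.1), by
    dsimp only
    rw [q.2.1.2, q.2.2.2]
    exact Finset.HasAntidiagonal.mem_antidiagonal.1 q.1.2⟩
  left_inv _ := rfl
  right_inv := by
    rintro ⟨⟨⟨i, j⟩, h⟩, ⟨a, ha⟩, ⟨b, hb⟩⟩
    dsimp only at ha hb
    subst ha hb
    rfl

lemma finite_sizeFiber_prod {α β : Type*} {s : α → ℕ} {t : β → ℕ}
    (hs : ∀ n, Finite (SizeFiber s n)) (ht : ∀ n, Finite (SizeFiber t n)) (n : ℕ) :
    Finite (SizeFiber (fun p : α × β => s p.1 + t p.2) n) :=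
  Finite.of_equiv _ (sizeFiberProdEquiv s t n).symm

lemma genFun_prod {α β : Type*} {s : α → ℕ} {t : β → ℕ} (hs : ∀ n, Finite (SizeFiber s n))
    (ht : ∀ n, Finite (SizeFiber t n)) :
    genFun (fun p : α × β => s p.1 + t p.2) = genFun s * genFun t := by
  ext n
  simp only [genFun, coeff_mk, coeff_mul]
  rw [Nat.card_congr (sizeFiberProdEquiv s t n), Nat.card_sigma, Nat.cast_sum,
    ← Finset.sum_coe_sort (Finset.HasAntidiagonal.antidiagonal n)]
  simp [Nat.card_prod]

lemma genFun_unit (m : ℕ) : genFun (fun _ : Unit => m) = X ^ m := by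
  ext n
  simp only [genFun, coeff_mk, coeff_X_pow]
  split_ifs with h
  · have : Unique (SizeFiber (fun _ : Unit => m) n) := ⟨⟨(), h.symm⟩, fun _ => rfl⟩
    simp
  · have : IsEmpty (SizeFiber (fun _ : Unit => m) n) := ⟨fun a => h a.2.symm⟩
    simp

namespace PTree

@[simp] lemma leaves_node_nil : (node []).leaves = 1 := by simp [leaves]

lemma leaves_node_cons (c : PTree) (cs : List PTree) :
    (node (c :: cs)).leaves = ((c :: cs).map leaves).sum := by
  rw [leaves, List.attach_map_val]

lemma good_node (cs : List PTree) : (node cs).Good ↔ cs.length ≠ 1 ∧ ∀ c ∈ cs, c.Good := by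
  simp [Good]

lemma leaves_pos : ∀ t : PTree, 0 < t.leaves
  | node [] => by simp
  | node (c :: cs) => by
    have := leaves_pos c
    rw [leaves_node_cons, List.map_cons, List.sum_cons]
    omega

end PTree

/-- Trees all of whose internal nodes have at least two children. -/
abbrev GoodTree : Type := {t : PTree // t.Good}

namespace GoodTree

/-- The number of leaves. -/
def size (t : GoodTree) : ℕ := t.1.leaves

/-- The total number of leaves of a forest. -/
def forestSize (l : List GoodTree) : ℕ := (l.map size).sum

lemma size_pos (t : GoodTree) : 0 < t.size := t.1.leaves_pos

/-- A good tree is either a leaf or a root with a first, a second and further children. -/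
def equivChildren : GoodTree ≃ Unit ⊕ GoodTree × GoodTree × List GoodTree where
  toFun
    | ⟨.node [], _⟩ => .inl ()
    | ⟨.node [_], h⟩ => (((PTree.good_node _).1 h).1 rfl).elim
    | ⟨.node (a :: b :: l), h⟩ =>
      have h' := ((PTree.good_node _).1 h).2
      .inr (⟨a, h' a (by simp)⟩, ⟨b, h' b (by simp)⟩,
        l.attachWith PTree.Good fun c hc => h' c (by simp [hc]))
  invFun
    | .inl _ => ⟨.node [], by simp [PTree.good_node]⟩
    | .inr (a, b, l) => ⟨.node (a.1 :: b.1 :: l.map (↑)), by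
        rw [PTree.good_node]
        refine ⟨by simp, fun c hc => ?_⟩
        simp only [List.mem_cons, List.mem_map] at hc
        obtain rfl | rfl | ⟨d, -, rfl⟩ := hc
        exacts [a.2, b.2, d.2]⟩
  left_inv
    | ⟨.node [], _⟩ => rfl
    | ⟨.node [_], h⟩ => (((PTree.good_node _).1 h).1 rfl).elim
    | ⟨.node (a :: b :: l), h⟩ => by simp
  right_inv
    | .inl _ => rfl
    | .inr (a, b, l) => by
      simp only [Sum.inr.injEq, Prod.mk.injEq, true_and]
      apply List.map_injective_iff.2 Subtype.val_injective
      simp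

/-- A forest is either empty or a tree followed by a forest. -/
def forestEquiv : List GoodTree ≃ Unit ⊕ GoodTree × List GoodTree where
  toFun
    | [] => .inl ()
    | a :: l => .inr (a, l)
  invFun
    | .inl _ => []
    | .inr (a, l) => a :: l
  left_inv
    | [] => rfl
    | _ :: _ => rfl
  right_inv
    | .inl _ => rfl
    | .inr _ => rfl

lemma size_equivChildren_symm (x : Unit ⊕ GoodTree × GoodTree × List GoodTree) :
    (equivChildren.symm x).size =
      Sum.elim (fun _ => 1) (fun p => size p.1 + (size p.2.1 + forestSize p.2.2)) x := by
  rcases x with _ | ⟨a, b, l⟩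
  · exact PTree.leaves_node_nil
  · change (PTree.node (a.1 :: b.1 :: l.map (↑))).leaves = _
    simp [PTree.leaves_node_cons, size, forestSize]

lemma forestSize_forestEquiv_symm (x : Unit ⊕ GoodTree × List GoodTree) :
    forestSize (forestEquiv.symm x) =
      Sum.elim (fun _ => 0) (fun p => size p.1 + forestSize p.2) x := by
  rcases x with _ | ⟨a, l⟩
  · rfl
  · simp [forestEquiv, forestSize]

lemma finite_sizeFiber (n : ℕ) :
    {t : GoodTree | t.size = n}.Finite ∧ {l | forestSize l = n}.Finite := by
  induction n using Nat.strong_induction_on with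
  | _ n ih =>
    have hlt : {t : GoodTree | t.size < n}.Finite := by
      refine ((Set.finite_lt_nat n).biUnion fun i hi => (ih i hi).1).subset fun t ht => ?_
      simpa using ht
    have hltF : {l | forestSize l < n}.Finite := by
      refine ((Set.finite_lt_nat n).biUnion fun i hi => (ih i hi).2).subset fun t ht => ?_
      simpa using ht
    have htree : {t : GoodTree | t.size = n}.Finite := by
      refine (((Set.finite_univ (α := Unit)).image Sum.inl).union
        ((hlt.prod (hlt.prod hltF)).image Sum.inr)).preimage
        equivChildren.injective.injOn |>.subset ?_
      intro t ht
      obtain ⟨x, rfl⟩ := equivChildren.symm.surjective t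
      rw [Set.mem_ofPred_eq, size_equivChildren_symm] at ht
      rcases x with _ | ⟨a, b, l⟩
      · simp
      · have := a.size_pos
        have := b.size_pos
        simp only [Sum.elim_inr] at ht
        simp only [Set.mem_preimage, Equiv.apply_symm_apply]
        exact Or.inr ⟨_, ⟨by simp; omega, by simp; omega, by simp; omega⟩, rfl⟩
    refine ⟨htree, ?_⟩
    refine (((Set.finite_univ (α := Unit)).image Sum.inl).union
      (((hlt.union htree).prod hltF).image Sum.inr)).preimage
      forestEquiv.injective.injOn |>.subset ?_
    intro t ht
    obtain ⟨x, rfl⟩ := forestEquiv.symm.surjective t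
    rw [Set.mem_ofPred_eq, forestSize_forestEquiv_symm] at ht
    rcases x with _ | ⟨a, l⟩
    · simp
    · have := a.size_pos
      simp only [Sum.elim_inr] at ht
      simp only [Set.mem_preimage, Equiv.apply_symm_apply]
      refine Or.inr ⟨_, ⟨?_, by simp; omega⟩, rfl⟩
      simp only [Set.mem_union, Set.mem_ofPred_eq]
      omega

lemma genFun_size :
    genFun size = X + genFun size * (genFun size * genFun forestSize) := by
  have hT n : Finite (SizeFiber size n) := (finite_sizeFiber n).1
  have hF n : Finite (SizeFiber forestSize n) := (finite_sizeFiber n).2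
  have hTF := finite_sizeFiber_prod hT hF
  rw [← genFun_prod hT hF, ← genFun_prod hT hTF, ← pow_one X, ← genFun_unit,
    ← genFun_sum (fun _ => inferInstance) (finite_sizeFiber_prod hT hTF)]
  exact (genFun_congr equivChildren.symm size_equivChildren_symm).symm

lemma genFun_forestSize :
    genFun forestSize = 1 + genFun size * genFun forestSize := by
  have hT n : Finite (SizeFiber size n) := (finite_sizeFiber n).1
  have hF n : Finite (SizeFiber forestSize n) := (finite_sizeFiber n).2
  rw [← genFun_prod hT hF, ← pow_zero X, ← genFun_unit,
    ← genFun_sum (fun _ => inferInstance) (finite_sizeFiber_prod hT hF)]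
  exact (genFun_congr forestEquiv.symm forestSize_forestEquiv_symm).symm

lemma genFun_size_quadratic :
    2 * genFun size ^ 2 - (1 + X) * genFun size + X = 0 := by
  have h : genFun forestSize = 2 * genFun size + 1 - X := by
    linear_combination (-1 : ℤ⟦X⟧) * genFun_size + (1 + genFun size) * genFun_forestSize
  have := genFun_forestSize
  rw [h] at this
  linear_combination -this

/-- The generating function of good trees with at least two leaves, with the size lowered by two. -/
noncomputable def shiftedGenFun : ℤ⟦X⟧ := PowerSeries.mk fun n => coeff (n + 2) (genFun size)

lemma coeff_zero_genFun_size : coeff 0 (genFun size) = 0 := by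
  have : IsEmpty (SizeFiber size 0) := ⟨fun t => t.1.size_pos.ne' t.2⟩
  simp [genFun]

lemma genFun_size_eq : genFun size = X + X ^ 2 * shiftedGenFun := by
  have h0 : constantCoeff (genFun size) = 0 := by
    rw [← coeff_zero_eq_constantCoeff_apply, coeff_zero_genFun_size]
  have h1 : coeff 1 (genFun size) = 1 := by
    have := congrArg (coeff 1) genFun_size
    simpa [coeff_mul, Finset.Nat.antidiagonal_succ, h0] using this
  ext n
  match n with
  | 0 => simp [h0]
  | 1 => rw [h1]; simp [coeff_X_pow_mul']
  | n + 2 =>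
    rw [map_add, add_comm n 2, coeff_X_pow_mul', if_pos (by omega)]
    simp [shiftedGenFun, coeff_X, add_comm]

lemma shiftedGenFun_quadratic :
    shiftedGenFun = 1 + 3 * X * shiftedGenFun + 2 * X ^ 2 * shiftedGenFun ^ 2 := by
  have h := genFun_size_quadratic
  rw [genFun_size_eq] at h
  apply mul_left_cancel₀ (pow_ne_zero 2 (X_ne_zero (R := ℤ)))
  linear_combination -h

end GoodTree

/-- `IsMotzkinFrom h p` says that the colored path `p`, started at height `h`, stays at nonnegative
height and ends at height `0`. -/
def IsMotzkinFrom : ℕ → List CMStep → Prop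
  | h, [] => h = 0
  | h, .U _ :: p => IsMotzkinFrom (h + 1) p
  | h, .H _ :: p => IsMotzkinFrom h p
  | 0, .D :: _ => False
  | h + 1, .D :: p => IsMotzkinFrom h p

lemma isMotzkinFrom_iff (p : List CMStep) (h : ℕ) : IsMotzkinFrom h p ↔
    h + mHeight (p.map CMStep.forget) = 0 ∧
      ∀ q, q <+: p.map CMStep.forget → 0 ≤ h + mHeight q := by
  have hcons (a : MStep) (l : List MStep) (h : ℕ) :
      (∀ q, q <+: a :: l → 0 ≤ h + mHeight q) ↔ ∀ q, q <+: l → 0 ≤ (h + a.dh) + mHeight q := by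
    simp only [List.prefix_cons_iff]
    constructor
    · intro H q hq
      have := H (a :: q) (Or.inr ⟨q, rfl, hq⟩)
      simp only [mHeight, List.map_cons, List.sum_cons] at this ⊢
      omega
    · rintro H q (rfl | ⟨q, rfl, hq⟩)
      · simp [mHeight]
      · have := H q hq
        simp only [mHeight, List.map_cons, List.sum_cons] at this ⊢
        omega
  induction p generalizing h with
  | nil => simp +contextual [IsMotzkinFrom, mHeight]
  | cons a p ih =>
    rw [List.map_cons, hcons]
    have hH (b : MStep) (l : List MStep) : mHeight (b :: l) = b.dh + mHeight l := by
      simp [mHeight]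
    rw [hH, ← add_assoc]
    cases a with
    | U b => simpa [IsMotzkinFrom, CMStep.forget, MStep.dh] using ih (h + 1)
    | H b => simpa [IsMotzkinFrom, CMStep.forget, MStep.dh] using ih h
    | D =>
      cases h with
      | zero =>
        simp only [IsMotzkinFrom, false_iff, not_and, not_forall]
        exact fun _ => ⟨[], List.nil_prefix, by simp [mHeight, CMStep.forget, MStep.dh]⟩
      | succ h => simpa [IsMotzkinFrom, CMStep.forget, MStep.dh] using ih h

/-- Colored paths of length `n` from height `h` to height `0`. -/
abbrev MotzkinFrom (n h : ℕ) : Type := {p : List CMStep // p.length = n ∧ IsMotzkinFrom h p}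

instance : Finite CMStep :=
  Finite.of_surjective
    (fun x : Bool ⊕ Bool ⊕ Unit => Sum.elim CMStep.U (Sum.elim CMStep.H fun _ => CMStep.D) x) (by
      rintro (b | b | _)
      exacts [⟨.inl b, rfl⟩, ⟨.inr (.inl b), rfl⟩, ⟨.inr (.inr ()), rfl⟩])

instance (n : ℕ) (P : List CMStep → Prop) : Finite {p : List CMStep // p.length = n ∧ P p} :=
  ((List.finite_length_eq CMStep n).subset fun _ hp => hp.1).to_subtype

/-- Decomposition of a colored path by its first step. -/
def motzkinFromSuccEquiv (n h : ℕ) : MotzkinFrom (n + 1) h ≃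
    Bool × MotzkinFrom n h ⊕ Bool × MotzkinFrom n (h + 1) ⊕
      {p : List CMStep // p.length = n ∧ IsMotzkinFrom h (.D :: p)} where
  toFun
    | ⟨[], hp⟩ => (by simp at hp : False).elim
    | ⟨.H b :: p, hp⟩ => .inl (b, ⟨p, by simpa [IsMotzkinFrom] using hp⟩)
    | ⟨.U b :: p, hp⟩ => .inr (.inl (b, ⟨p, by simpa [IsMotzkinFrom] using hp⟩))
    | ⟨.D :: p, hp⟩ => .inr (.inr ⟨p, by simpa using hp⟩)
  invFun
    | .inl (b, p) => ⟨.H b :: p.1, by simpa [IsMotzkinFrom] using p.2⟩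
    | .inr (.inl (b, p)) => ⟨.U b :: p.1, by simpa [IsMotzkinFrom] using p.2⟩
    | .inr (.inr p) => ⟨.D :: p.1, by simpa using p.2⟩
  left_inv
    | ⟨[], hp⟩ => (by simp at hp : False).elim
    | ⟨.H b :: p, hp⟩ => rfl
    | ⟨.U b :: p, hp⟩ => rfl
    | ⟨.D :: p, hp⟩ => rfl
  right_inv
    | .inl (b, p) => rfl
    | .inr (.inl (b, p)) => rfl
    | .inr (.inr p) => rfl

lemma card_motzkinFrom_zero (h : ℕ) : Nat.card (MotzkinFrom 0 h) = if h = 0 then 1 else 0 := by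
  split_ifs with hh
  · subst hh
    have : Unique (MotzkinFrom 0 0) :=
      { default := ⟨[], rfl, rfl⟩
        uniq := fun p => Subtype.ext (List.length_eq_zero_iff.1 p.2.1) }
    exact Nat.card_unique
  · have : IsEmpty (MotzkinFrom 0 h) := ⟨fun ⟨p, hp, hp'⟩ => by
      obtain rfl := List.length_eq_zero_iff.1 hp
      exact hh hp'⟩
    exact Nat.card_of_isEmpty

lemma card_motzkinFrom_succ_zero (n : ℕ) : Nat.card (MotzkinFrom (n + 1) 0) =
    2 * Nat.card (MotzkinFrom n 0) + 2 * Nat.card (MotzkinFrom n 1) := by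
  rw [Nat.card_congr (motzkinFromSuccEquiv n 0), Nat.card_sum, Nat.card_sum]
  simp [Nat.card_prod, IsMotzkinFrom]

lemma card_motzkinFrom_succ_succ (n h : ℕ) : Nat.card (MotzkinFrom (n + 1) (h + 1)) =
    2 * Nat.card (MotzkinFrom n (h + 1)) + 2 * Nat.card (MotzkinFrom n (h + 2)) +
      Nat.card (MotzkinFrom n h) := by
  rw [Nat.card_congr (motzkinFromSuccEquiv n (h + 1)), Nat.card_sum, Nat.card_sum]
  simp [Nat.card_prod, IsMotzkinFrom, add_assoc]

/-- The binomial transform of a sequence. -/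
def binomTransform (a : ℕ → ℕ) (n : ℕ) : ℕ := ∑ k ∈ Finset.range (n + 1), n.choose k * a k

lemma binomTransform_succ (a : ℕ → ℕ) (n : ℕ) :
    binomTransform a (n + 1) = binomTransform a n + binomTransform (fun k => a (k + 1)) n := by
  have h : binomTransform a n =
      ∑ k ∈ Finset.range (n + 1), n.choose (k + 1) * a (k + 1) + a 0 := by
    have := Finset.sum_range_succ' (fun k => n.choose k * a k) (n + 1)
    rw [Finset.sum_range_succ] at this
    simpa [binomTransform] using this
  rw [h, binomTransform, binomTransform, Finset.sum_range_succ']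
  simp only [Nat.choose_succ_succ, add_mul, Finset.sum_add_distrib]
  simp
  ring

lemma binomTransform_card_motzkinFrom (n h : ℕ) :
    (binomTransform (fun k => Nat.card (MotzkinFrom k h)) n : ℤ) =
      coeff n (GoodTree.shiftedGenFun ^ (h + 1) * X ^ h) := by
  have hB := GoodTree.shiftedGenFun_quadratic
  set B := GoodTree.shiftedGenFun
  induction n generalizing h with
  | zero =>
    have hB0 : constantCoeff B = 1 := by
      have := congrArg constantCoeff hB
      simpa using this
    cases h <;> simp [binomTransform, card_motzkinFrom_zero, hB0]
  | succ n ih =>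
    rw [binomTransform_succ]
    cases h with
    | zero =>
      have hrec : B ^ (0 + 1) * X ^ 0 =
          1 + X * (3 * (B ^ (0 + 1) * X ^ 0) + 2 * (B ^ (1 + 1) * X ^ 1)) := by
        linear_combination hB
      rw [hrec, map_add, coeff_succ_X_mul, map_add]
      simp only [← nsmul_eq_mul, ← Nat.cast_ofNat (R := ℤ⟦X⟧), map_nsmul, ← ih]
      simp only [card_motzkinFrom_succ_zero, binomTransform, mul_add, Finset.sum_add_distrib,
        mul_left_comm _ 2, ← Finset.mul_sum, coeff_one]
      push_cast
      simp
      ring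
    | succ h =>
      have hrec : B ^ (h + 1 + 1) * X ^ (h + 1) =
          X * (3 * (B ^ (h + 1 + 1) * X ^ (h + 1)) + 2 * (B ^ (h + 2 + 1) * X ^ (h + 2)) +
            B ^ (h + 1) * X ^ h) := by
        linear_combination B ^ (h + 1) * X ^ (h + 1) * hB
      rw [hrec, coeff_succ_X_mul, map_add, map_add]
      simp only [← nsmul_eq_mul, ← Nat.cast_ofNat (R := ℤ⟦X⟧), map_nsmul, ← ih]
      simp only [card_motzkinFrom_succ_succ, binomTransform, mul_add, Finset.sum_add_distrib,
        mul_left_comm _ 2, ← Finset.mul_sum]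
      push_cast
      simp
      ring

lemma card_huMP (k : ℕ) : Nat.card (huMP (k + 1)) = Nat.card (MotzkinFrom k 0) :=
  Nat.card_congr (Equiv.subtypeEquivRight fun p => by
    simp [IsMotzkin, isMotzkinFrom_iff])

lemma card_PTn (n : ℕ) : Nat.card (PTn n) = Nat.card (SizeFiber GoodTree.size (n + 1)) :=
  Nat.card_congr (Equiv.subtypeSubtypeEquivSubtypeInter _ _).symm


/-- |PT(n)| = Σ_{k=1}^{n} binom(n−1,k−1)·|huMP(k)|. -/
theorem statement12 (n : ℕ) (hn : 1 ≤ n) :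
    Nat.card (PTn n) = ∑ k ∈ Finset.Icc 1 n, (n - 1).choose (k - 1) * Nat.card (huMP k) := by
  obtain ⟨n, rfl⟩ := Nat.exists_eq_add_of_le' hn
  have h := binomTransform_card_motzkinFrom n 0
  simp only [GoodTree.shiftedGenFun, genFun, zero_add, pow_one, pow_zero, mul_one, coeff_mk,
    Nat.cast_inj] at h
  rw [card_PTn, ← h, binomTransform, ← Finset.Ico_add_one_right_eq_Icc, Finset.sum_Ico_eq_sum_range]
  simp [add_comm 1, card_huMP]
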